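/- Let r ≥ 13 be an integer and let G be an r-minimal graph. If v is a vertex of G with d_G(v) = 3, then Δ(G) = r and every neighbor of v has degree exactly r in G. -/

import Mathlib

/-- A total `k`-coloring of a simple graph `G`: colors from `Fin k` are assigned to all
vertices and to all edges so that adjacent vertices get distinct colors, distinct edges
sharing an endpoint get distinct colors, and each edge gets a color distinct from the
colors of both of its endpoints. -/
def HasTotalColoring {V : Type*} (G : SimpleGraph V) (k : ℕ) : Prop :=
  ∃ (cV : V → Fin k) (cE : Sym2 V → Fin k),
    (∀ u v : V, G.Adj u v → cV u ≠ cV v) ∧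
    (∀ e₁ ∈ G.edgeSet, ∀ e₂ ∈ G.edgeSet, e₁ ≠ e₂ → (∃ x, x ∈ e₁ ∧ x ∈ e₂) →
      cE e₁ ≠ cE e₂) ∧
    (∀ e ∈ G.edgeSet, ∀ x ∈ e, cE e ≠ cV x)

/-- For `r ≥ 13`, a graph is `r`-minimal if it is a finite connected simple graph with
maximum degree at most `r` admitting no total `(r+2)`-coloring, such that deleting any
edge yields a graph admitting a total `(r+2)`-coloring. -/
def IsRMinimal {V : Type*} [Fintype V] (r : ℕ) (G : SimpleGraph V)
    [DecidableRel G.Adj] : Prop :=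
  G.Connected ∧ G.maxDegree ≤ r ∧ ¬ HasTotalColoring G (r + 2) ∧
    ∀ e ∈ G.edgeSet, HasTotalColoring (G.deleteEdges {e}) (r + 2)

/-- A total coloring of `G` minus an edge `vu` extends to `G` (after recoloring `v`) as soon as
there are enough colors for the edge `vu` and then for the vertex `v`. -/
theorem HasTotalColoring.of_deleteEdges {V : Type*} [Fintype V] {G : SimpleGraph V}
    [DecidableRel G.Adj] {k : ℕ} {v u : V} (hvu : G.Adj v u)
    (hsum : G.degree u + G.degree v ≤ k) (hdeg : 2 * G.degree v < k)
    (h : HasTotalColoring (G.deleteEdges {s(v, u)}) k) : HasTotalColoring G k := by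
  classical
  obtain ⟨cV, cE, hV, hE, hVE⟩ := h
  have exists_color (S : Finset (Fin k)) (hS : S.card < k) : ∃ c, c ∉ S := by
    by_contra! hall
    have := Finset.card_le_card (fun c _ => hall c : (Finset.univ : Finset (Fin k)) ⊆ S)
    rw [Finset.card_univ, Fintype.card_fin] at this
    omega
  have hu : v ∈ G.neighborFinset u := by simpa using hvu.symm
  have hv : u ∈ G.neighborFinset v := by simpa using hvu
  obtain ⟨c, hc⟩ := exists_color
    (insert (cV u) (((G.neighborFinset u).erase v).image (fun w => cE s(u, w)) ∪
      ((G.neighborFinset v).erase u).image (fun w => cE s(v, w)))) (by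
    have h₁ := Finset.card_insert_le (cV u)
      (((G.neighborFinset u).erase v).image (fun w => cE s(u, w)) ∪
        ((G.neighborFinset v).erase u).image (fun w => cE s(v, w)))
    have h₂ := Finset.card_union_le
      (((G.neighborFinset u).erase v).image (fun w => cE s(u, w)))
      (((G.neighborFinset v).erase u).image (fun w => cE s(v, w)))
    have h₃ := Finset.card_image_le (s := (G.neighborFinset u).erase v)
      (f := fun w => cE s(u, w))
    have h₄ := Finset.card_image_le (s := (G.neighborFinset v).erase u)
      (f := fun w => cE s(v, w))
    have h₅ := Finset.card_pos.2 ⟨_, hu⟩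
    have h₆ := Finset.card_pos.2 ⟨_, hv⟩
    rw [Finset.card_erase_of_mem hu] at h₃
    rw [Finset.card_erase_of_mem hv] at h₄
    rw [SimpleGraph.card_neighborFinset_eq_degree] at h₃ h₄ h₅ h₆
    omega)
  simp only [Finset.mem_insert, Finset.mem_union, Finset.mem_image, Finset.mem_erase,
    SimpleGraph.mem_neighborFinset, not_or, not_exists, not_and, and_imp] at hc
  obtain ⟨hcu, hcu', hcv'⟩ := hc
  set cE' := Function.update cE s(v, u) c with hcE'
  obtain ⟨d, hd⟩ := exists_color
    ((G.neighborFinset v).image cV ∪ (G.neighborFinset v).image (fun w => cE' s(v, w))) (by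
    have h₁ := Finset.card_union_le ((G.neighborFinset v).image cV)
      ((G.neighborFinset v).image (fun w => cE' s(v, w)))
    have h₂ := Finset.card_image_le (s := G.neighborFinset v) (f := cV)
    have h₃ := Finset.card_image_le (s := G.neighborFinset v) (f := fun w => cE' s(v, w))
    rw [SimpleGraph.card_neighborFinset_eq_degree] at h₂ h₃
    omega)
  simp only [Finset.mem_union, Finset.mem_image, SimpleGraph.mem_neighborFinset, not_or,
    not_exists, not_and] at hd
  obtain ⟨hdV, hdE⟩ := hd
  have mem_delete {e : Sym2 V} (he : e ∈ G.edgeSet) (hne : e ≠ s(v, u)) :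
      e ∈ (G.deleteEdges {s(v, u)}).edgeSet := by
    rw [SimpleGraph.edgeSet_deleteEdges]
    exact ⟨he, hne⟩
  have new_edge {e : Sym2 V} (he : e ∈ G.edgeSet) (hne : e ≠ s(v, u))
      (hx : ∃ x, x ∈ s(v, u) ∧ x ∈ e) : cE e ≠ c := by
    obtain ⟨x, hx, w, rfl⟩ := hx
    rw [SimpleGraph.mem_edgeSet] at he
    rcases Sym2.mem_iff.1 hx with rfl | rfl
    · exact hcv' w (fun hw => hne (by rw [hw])) he
    · exact hcu' w (fun hw => hne (by rw [hw, Sym2.eq_swap])) he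
  refine ⟨Function.update cV v d, cE', ?_, ?_, ?_⟩
  · intro a b hab
    by_cases ha : a = v
    · subst ha
      rw [Function.update_self, Function.update_of_ne hab.ne']
      exact Ne.symm (hdV b hab)
    by_cases hb : b = v
    · subst hb
      rw [Function.update_self, Function.update_of_ne hab.ne]
      exact hdV a hab.symm
    rw [Function.update_of_ne ha, Function.update_of_ne hb]
    refine hV a b (mem_delete (e := s(a, b)) hab fun hs => ?_)
    rcases Sym2.eq_iff.1 hs with h | h
    · exact ha h.1
    · exact hb h.2
  · intro e₁ he₁ e₂ he₂ hne hx
    by_cases h₁ : e₁ = s(v, u)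
    · subst h₁
      rw [hcE', Function.update_self, Function.update_of_ne hne.symm]
      exact (new_edge he₂ hne.symm hx).symm
    by_cases h₂ : e₂ = s(v, u)
    · subst h₂
      rw [hcE', Function.update_self, Function.update_of_ne hne]
      exact new_edge he₁ hne (hx.imp fun _ h => h.symm)
    rw [hcE', Function.update_of_ne h₁, Function.update_of_ne h₂]
    exact hE e₁ (mem_delete he₁ h₁) e₂ (mem_delete he₂ h₂) hne hx
  · intro e he x hx
    by_cases hxv : x = v
    · subst hxv
      obtain ⟨w, rfl⟩ := hx
      rw [Function.update_self]
      exact hdE w he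
    rw [Function.update_of_ne hxv]
    by_cases h₁ : e = s(v, u)
    · subst h₁
      rw [hcE', Function.update_self]
      obtain rfl := (Sym2.mem_iff.1 hx).resolve_left hxv
      exact hcu
    rw [hcE', Function.update_of_ne h₁]
    exact hVE e (mem_delete he h₁) x hx

/-- In an r-minimal graph (r ≥ 13), if v has degree 3, then Δ(G) = r
and every neighbor of v has degree exactly r. -/
theorem stmt_6 {V : Type*} [Fintype V] (r : ℕ) (hr : 13 ≤ r)
    (G : SimpleGraph V) [DecidableRel G.Adj] (hG : IsRMinimal r G)
    (v : V) (hv : G.degree v = 3) :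
    G.maxDegree = r ∧ ∀ u : V, G.Adj v u → G.degree u = r := by
  obtain ⟨-, hmax, hnot, hdel⟩ := hG
  have key (u : V) (hvu : G.Adj v u) : G.degree u = r := by
    refine ((G.degree_le_maxDegree u).trans hmax).antisymm ?_
    by_contra! hlt
    exact hnot (.of_deleteEdges hvu (by omega) (by omega) (hdel s(v, u) hvu))
  refine ⟨hmax.antisymm ?_, key⟩
  obtain ⟨u, hvu⟩ := (G.degree_pos_iff_exists_adj v).1 (by omega)
  exact (key u hvu).symm.le.trans (G.degree_le_maxDegree u)
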